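/- Let m be a positive integer and let f_1 : I_1 → ℝ, f_2 : I_2 → ℝ, f_3 : I_3 → ℝ be smooth functions on open intervals such that f_i'(t) ≠ 0 and f_i''(t) ≠ 0 for all t in the respective interval, i = 1,2,3. Then it is impossible that for all (u_1,u_2,u_3) ∈ I_1 × I_2 × I_3: (f_1'(u_1))^{-(2m-2)/(2m-1)} f_1''(u_1) (1 + (f_2'(u_2))^{2m/(2m-1)} + (f_3'(u_3))^{2m/(2m-1)}) + (f_2'(u_2))^{-(2m-2)/(2m-1)} f_2''(u_2) (1 + (f_1'(u_1))^{2m/(2m-1)} + (f_3'(u_3))^{2m/(2m-1)}) + (f_3'(u_3))^{-(2m-2)/(2m-1)} f_3''(u_3) (1 + (f_1'(u_1))^{2m/(2m-1)} + (f_2'(u_2))^{2m/(2m-1)}) = 0. -/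

import Mathlib

/-- The real `(2m-1)`-th root of `y`: the unique real number `s` with `s^(2m-1) = y`.
For `y ≠ 0`, the fractional power `y^(p/(2m-1))` is interpreted as `(oddRoot m y)^p`. -/
noncomputable def oddRoot (m : ℕ) (y : ℝ) : ℝ :=
  Real.sign y * |y| ^ ((2 * (m : ℝ) - 1)⁻¹)

lemma oddRoot_ne_zero (m : ℕ) {y : ℝ} (hy : y ≠ 0) : oddRoot m y ≠ 0 :=
  mul_ne_zero (by simpa [Real.sign_eq_zero_iff] using hy)
    (Real.rpow_pos_of_pos (abs_pos.mpr hy) _).ne'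

lemma abs_oddRoot (m : ℕ) {y : ℝ} (hy : y ≠ 0) :
    |oddRoot m y| = |y| ^ ((2 * (m : ℝ) - 1)⁻¹) := by
  have h : |Real.sign y| = 1 := by
    rcases Real.sign_apply_eq_of_ne_zero y hy with h | h <;> simp [h]
  rw [oddRoot, abs_mul, h, one_mul, abs_of_nonneg (Real.rpow_nonneg (abs_nonneg y) _)]

lemma sq_eq_sq_of_oddRoot_pow_eq {m : ℕ} (hm : 1 ≤ m) {x y : ℝ} (hx : x ≠ 0) (hy : y ≠ 0)
    (h : oddRoot m x ^ (2 * m) = oddRoot m y ^ (2 * m)) : x ^ 2 = y ^ 2 := by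
  have hm' : (1 : ℝ) ≤ m := by exact_mod_cast hm
  rw [← (even_two_mul m).pow_abs, ← (even_two_mul m).pow_abs (oddRoot m y)] at h
  have habs := (pow_left_inj₀ (abs_nonneg _) (abs_nonneg _) (by omega)).mp h
  rw [abs_oddRoot m hx, abs_oddRoot m hy] at habs
  exact (sq_eq_sq_iff_abs_eq_abs x y).mpr <|
    (Real.rpow_left_inj (abs_nonneg _) (abs_nonneg _) (inv_ne_zero (by linarith))).mp habs

/-- If `g` and `g'` do not vanish on an open interval, then `g ^ (2m/(2m-1))` is not constant
there. -/
lemma exists_oddRoot_pow_ne {m : ℕ} (hm : 1 ≤ m) {a b : ℝ} (hab : a < b) {g : ℝ → ℝ}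
    (hg : ∀ t ∈ Set.Ioo a b, g t ≠ 0) (hg' : ∀ t ∈ Set.Ioo a b, deriv g t ≠ 0) :
    ∃ p ∈ Set.Ioo a b, ∃ q ∈ Set.Ioo a b,
      oddRoot m (g p) ^ (2 * m) ≠ oddRoot m (g q) ^ (2 * m) := by
  obtain ⟨p, hp⟩ := Set.nonempty_Ioo.mpr hab
  by_contra! h
  have hconst : (fun t => g t ^ 2) =ᶠ[nhds p] fun _ => g p ^ 2 := by
    filter_upwards [isOpen_Ioo.mem_nhds hp] with t ht
    exact sq_eq_sq_of_oddRoot_pow_eq hm (hg t ht) (hg p hp) (h t ht p hp)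
  have hd := (differentiableAt_of_deriv_ne_zero (hg' p hp)).hasDerivAt.pow 2
  have hzero := hd.unique ((hasDerivAt_const p (g p ^ 2)).congr_of_eventuallyEq hconst)
  simp [hg p hp, hg' p hp] at hzero

/-- The equation `∑ hⱼ (1 + ∑_{i ≠ j} yᵢ) = 0` cannot hold on a product of three two-point sets on
each of which `yᵢ` takes two distinct values, unless `h₀` vanishes. -/
lemma eq_zero_of_sum_mul_one_add_sum_eq_zero {h y h' y' : Fin 3 → ℝ} (hy : ∀ i, y i ≠ y' i)
    (H : ∀ s : Fin 3 → Bool,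
      ∑ j, (if s j then h j else h' j) *
        (1 + ∑ i ∈ Finset.univ.erase j, if s i then y i else y' i) = 0) :
    h 0 = 0 := by
  have B0 := sub_ne_zero.mpr (hy 0)
  have B1 := sub_ne_zero.mpr (hy 1)
  have B2 := sub_ne_zero.mpr (hy 2)
  have H1 := H ![true, true, true]
  have H2 := H ![false, true, true]
  have H3 := H ![true, false, true]
  have H4 := H ![true, true, false]
  have H5 := H ![false, false, true]
  have H6 := H ![false, true, false]
  have H7 := H ![true, false, false]
  simp [Fin.sum_univ_three] at H1 H2 H3 H4 H5 H6 H7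
  have A01 : (h 0 - h' 0) * (y 1 - y' 1) + (h 1 - h' 1) * (y 0 - y' 0) = 0 := by
    linear_combination H1 - H2 - H3 + H5
  have A02 : (h 0 - h' 0) * (y 2 - y' 2) + (h 2 - h' 2) * (y 0 - y' 0) = 0 := by
    linear_combination H1 - H2 - H4 + H6
  have A12 : (h 1 - h' 1) * (y 2 - y' 2) + (h 2 - h' 2) * (y 1 - y' 1) = 0 := by
    linear_combination H1 - H3 - H4 + H7
  have D0 : h 0 - h' 0 = 0 := by
    have : 2 * (h 0 - h' 0) * ((y 1 - y' 1) * (y 2 - y' 2)) = 0 := by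
      linear_combination (y 2 - y' 2) * A01 + (y 1 - y' 1) * A02 - (y 0 - y' 0) * A12
    simpa [B1, B2] using this
  have D1 : h 1 - h' 1 = 0 := by simpa [D0, B0] using A01
  have D2 : h 2 - h' 2 = 0 := by simpa [D0, B0] using A02
  have S0 : h 1 + h 2 = 0 := by
    refine (mul_eq_zero.mp ?_).resolve_right B0
    linear_combination H1 - H2 - D0 * (1 + (y 1 + y 2))
  have S1 : h 0 + h 2 = 0 := by
    refine (mul_eq_zero.mp ?_).resolve_right B1
    linear_combination H1 - H3 - D1 * (1 + (y 0 + y 2))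
  have S2 : h 0 + h 1 = 0 := by
    refine (mul_eq_zero.mp ?_).resolve_right B2
    linear_combination H1 - H4 - D2 * (1 + (y 0 + y 1))
  linarith

/-- there is no translation minimal hypersurface
`x₄ = f₁(u₁)+f₂(u₂)+f₃(u₃)` in `(ℝ⁴, ‖·‖_{2m})` with all `fᵢ'` and `fᵢ''`
nowhere vanishing. -/
theorem no_translation_minimal_n3 (m : ℕ) (hm : 1 ≤ m)
    (a b : Fin 3 → ℝ) (hab : ∀ i, a i < b i)
    (f : Fin 3 → ℝ → ℝ)
    (hf : ∀ i, ContDiffOn ℝ (⊤ : ℕ∞) (f i) (Set.Ioo (a i) (b i)))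
    (hf1 : ∀ i, ∀ t ∈ Set.Ioo (a i) (b i), deriv (f i) t ≠ 0)
    (hf2 : ∀ i, ∀ t ∈ Set.Ioo (a i) (b i), deriv (deriv (f i)) t ≠ 0) :
    ¬ (∀ u : Fin 3 → ℝ, (∀ i, u i ∈ Set.Ioo (a i) (b i)) →
        ∑ j, ((oddRoot m (deriv (f j) (u j))) ^ (2 * m - 2))⁻¹
            * deriv (deriv (f j)) (u j)
            * (1 + ∑ i ∈ Finset.univ.erase j,
                (oddRoot m (deriv (f i) (u i))) ^ (2 * m)) = 0) := by
  intro H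
  choose p hp q hq hpq using fun i => exists_oddRoot_pow_ne hm (hab i) (hf1 i) (hf2 i)
  let h (i : Fin 3) (t : ℝ) : ℝ :=
    ((oddRoot m (deriv (f i) t)) ^ (2 * m - 2))⁻¹ * deriv (deriv (f i)) t
  refine mul_ne_zero (inv_ne_zero (pow_ne_zero _ (oddRoot_ne_zero m (hf1 0 _ (hp 0)))))
    (hf2 0 _ (hp 0)) (eq_zero_of_sum_mul_one_add_sum_eq_zero (h := fun i => h i (p i))
      (h' := fun i => h i (q i)) hpq fun s => ?_)
  have hs := H (fun i => if s i then p i else q i) fun i => by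
    cases s i <;> simp [hp, hq]
  convert hs using 3 with j
  · split_ifs <;> rfl
  · refine congrArg (1 + ·) (Finset.sum_congr rfl fun i _ => ?_)
    split_ifs <;> rfl
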